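/- Let R be a Gorenstein commutative Noetherian local ring of Krull dimension d, and let M and N be nonzero finitely generated R-modules with M maximal Cohen-Macaulay. Set t = depth(N). If Hom_R(M,N) has finite injective dimension and Ext_R^i(M,N) = 0 for all 1 ≤ i ≤ t, then M is free and N has finite injective dimension. -/

import Mathlib

open CategoryTheory

noncomputable section

/-- The `i`-th Ext module of two `R`-modules. -/
def extMod (R : Type) [CommRing R] (i : ℕ) (M N : Type) [AddCommGroup M] [Module R M]
    [AddCommGroup N] [Module R N] : ModuleCat R :=
  ((Ext R (ModuleCat R) i).obj (Opposite.op (ModuleCat.of R M))).obj (ModuleCat.of R N)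

/-- The `i`-th Tor module of two `R`-modules. -/
def torMod (R : Type) [CommRing R] (i : ℕ) (M N : Type) [AddCommGroup M] [Module R M]
    [AddCommGroup N] [Module R N] : ModuleCat R :=
  ((Tor (ModuleCat R) i).obj (ModuleCat.of R M)).obj (ModuleCat.of R N)

/-- The depth of a module over a local ring: the infimum of the set of
indices `i` with `Ext^i(R/𝔪, N) ≠ 0`. -/
def moduleDepth (R : Type) [CommRing R] [IsLocalRing R] (N : Type) [AddCommGroup N]
    [Module R N] : ℕ :=
  sInf {i : ℕ | ¬ Subsingleton (extMod R i (R ⧸ IsLocalRing.maximalIdeal R) N)}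

/-- An `R`-module `N` has finite injective dimension iff there is an `n` such that
`Ext^i(M, N) = 0` for all modules `M` and all `i > n`. -/
def HasFiniteInjDim (R : Type) [CommRing R] (N : Type) [AddCommGroup N] [Module R N] : Prop :=
  ∃ n : ℕ, ∀ (M : Type) [AddCommGroup M] [Module R M], ∀ i : ℕ, n < i →
    Subsingleton (extMod R i M N)

/-- An `R`-module `M` has finite projective dimension iff there is an `n` such that
`Ext^i(M, N) = 0` for all modules `N` and all `i > n`. -/
def HasFiniteProjDim (R : Type) [CommRing R] (M : Type) [AddCommGroup M] [Module R M] : Prop :=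
  ∃ n : ℕ, ∀ (N : Type) [AddCommGroup N] [Module R N], ∀ i : ℕ, n < i →
    Subsingleton (extMod R i M N)

/-- The `𝔪`-torsion submodule `Γ_𝔪(M)` of a module over a local ring. -/
def mTorsion (R : Type) [CommRing R] [IsLocalRing R] (M : Type) [AddCommGroup M]
    [Module R M] : Submodule R M :=
  ⨆ n : ℕ, Submodule.torsionBySet R M ((IsLocalRing.maximalIdeal R ^ n : Ideal R) : Set R)

/-- A semidualizing module: the natural map `R → Hom(C,C)` is bijective and
`Ext^i(C,C) = 0` for all `i ≥ 1`. -/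
structure IsSemidualizing (R : Type) [CommRing R] (C : Type) [AddCommGroup C]
    [Module R C] : Prop where
  bijective : Function.Bijective (LinearMap.lsmul R C)
  ext_vanish : ∀ i : ℕ, 1 ≤ i → Subsingleton (extMod R i C C)

/-- Membership in the Auslander class `A_C(R)`: the natural map `M → Hom(C, C ⊗ M)` is
bijective, `Tor_i(C, M) = 0` and `Ext^i(C, C ⊗ M) = 0` for all `i ≥ 1`. -/
structure MemAuslanderClass (R : Type) [CommRing R] (C : Type) [AddCommGroup C] [Module R C]
    (M : Type) [AddCommGroup M] [Module R M] : Prop where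
  bijective : Function.Bijective ((TensorProduct.mk R C M).flip)
  tor_vanish : ∀ i : ℕ, 1 ≤ i → Subsingleton (torMod R i C M)
  ext_vanish : ∀ i : ℕ, 1 ≤ i → Subsingleton (extMod R i C (TensorProduct R C M))

/-- A module `N` is Tor-rigid if for every finitely generated module `M` and every `i ≥ 1`,
`Tor_i(M, N) = 0` implies `Tor_{i+1}(M, N) = 0`. -/
def IsTorRigid (R : Type) [CommRing R] (N : Type) [AddCommGroup N] [Module R N] : Prop :=
  ∀ (M : Type) [AddCommGroup M] [Module R M], Module.Finite R M →
    ∀ i : ℕ, 1 ≤ i → Subsingleton (torMod R i M N) → Subsingleton (torMod R (i + 1) M N)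

/-- The natural map `C ⊗ Hom(M,N) → Hom(M, C ⊗ N)`, sending `c ⊗ φ` to `m ↦ c ⊗ φ m`. -/
def homTensorMap (R : Type) [CommRing R] (C M N : Type) [AddCommGroup C] [Module R C]
    [AddCommGroup M] [Module R M] [AddCommGroup N] [Module R N] :
    TensorProduct R C (M →ₗ[R] N) →ₗ[R] (M →ₗ[R] TensorProduct R C N) :=
  TensorProduct.lift
    ((LinearMap.llcomp R M N (TensorProduct R C N)).comp (TensorProduct.mk R C N))

open Limits in
theorem isZero_homology_linearYonedaObj_iff {R : Type} [CommRing R] {X : ModuleCat.{0} R}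
    (P : ProjectiveResolution X) (Y : ModuleCat.{0} R) (n : ℕ) :
    IsZero ((P.complex.linearYonedaObj R Y).homology n) ↔ Subsingleton (Abelian.Ext X Y n) := by
  rw [← HomologicalComplex.exactAt_iff_isZero_homology]
  match n with
  | 0 =>
    rw [(P.complex.linearYonedaObj R Y).exactAt_iff' 0 0 1 (by simp) (by simp),
      ShortComplex.moduleCat_exact_iff]
    constructor
    · intro h
      refine subsingleton_of_forall_eq 0 fun a => ?_
      obtain ⟨f, hf, rfl⟩ := P.extMk_surjective a 1 rfl
      obtain ⟨g, hg⟩ := h f hf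
      have h0 : f = 0 := by
        rw [← hg]
        change P.complex.d 0 0 ≫ (g : P.complex.X 0 ⟶ Y) = 0
        rw [P.complex.shape 0 0 (by simp)]
        exact zero_comp
      subst h0
      exact P.extMk_zero 1 rfl
    · intro h x hx
      have hx' : P.complex.d 1 0 ≫ (x : P.complex.X 0 ⟶ Y) = 0 := hx
      have : Subsingleton (X ⟶ Y) := Abelian.Ext.homEquiv₀.subsingleton_congr.1 h
      have hepi : Epi (ShortComplex.mk _ _ P.complex_d_comp_π_f_zero).g :=
        inferInstanceAs (Epi (P.π.f 0))
      have hfac := P.exact₀.g_desc (k := (x : P.complex.X 0 ⟶ Y)) hx'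
      rw [show P.exact₀.desc (x : P.complex.X 0 ⟶ Y) hx' = 0 from
        Subsingleton.elim (α := (X ⟶ Y)) _ _, comp_zero] at hfac
      exact ⟨0, (map_zero _).trans hfac⟩
  | n + 1 =>
    rw [(P.complex.linearYonedaObj R Y).exactAt_iff' n (n + 1) (n + 2) (by simp) (by simp),
      ShortComplex.moduleCat_exact_iff]
    constructor
    · intro h
      refine subsingleton_of_forall_eq 0 fun a => ?_
      obtain ⟨f, hf, rfl⟩ := P.extMk_surjective a (n + 2) rfl
      rw [P.extMk_eq_zero_iff _ _ _ _ n rfl]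
      exact h f hf
    · intro h x hx
      exact (P.extMk_eq_zero_iff x (n + 2) rfl hx n rfl).1 (Subsingleton.elim _ _)

theorem subsingleton_extMod_iff {R : Type} [CommRing R] (i : ℕ) (M N : Type) [AddCommGroup M]
    [Module R M] [AddCommGroup N] [Module R N] :
    Subsingleton (extMod R i M N) ↔
      Subsingleton (Abelian.Ext (ModuleCat.of R M) (ModuleCat.of R N) i) := by
  let P := projectiveResolution (ModuleCat.of R M)
  rw [← isZero_homology_linearYonedaObj_iff P, ← (P.isoExt (R := R) i (ModuleCat.of R N)).isZero_iff,
    ModuleCat.isZero_iff_subsingleton]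
  rfl

section ExtVanishing

variable {R : Type} [CommRing R] {A B C Y : Type} [AddCommGroup A] [Module R A]
  [AddCommGroup B] [Module R B] [AddCommGroup C] [Module R C] [AddCommGroup Y] [Module R Y]

theorem extMod_zero_subsingleton_iff : Subsingleton (extMod R 0 A Y) ↔ Subsingleton (A →ₗ[R] Y) :=
  (subsingleton_extMod_iff 0 A Y).trans <| Abelian.Ext.homEquiv₀.subsingleton_congr.trans
    ModuleCat.homAddEquiv.toEquiv.subsingleton_congr

theorem subsingleton_extMod_of_equiv_left (e : A ≃ₗ[R] B) {i : ℕ}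
    (h : Subsingleton (extMod R i A Y)) : Subsingleton (extMod R i B Y) :=
  @Equiv.subsingleton _ _ (((Ext R (ModuleCat R) i).mapIso e.toModuleIso.op).app
    (ModuleCat.of R Y)).toLinearEquiv.toEquiv h

theorem subsingleton_extMod_of_retract_right (s : A →ₗ[R] B) (r : B →ₗ[R] A)
    (h : r ∘ₗ s = LinearMap.id) {i : ℕ} (hB : Subsingleton (extMod R i Y B)) :
    Subsingleton (extMod R i Y A) := by
  let F := (Ext R (ModuleCat R) i).obj (Opposite.op (ModuleCat.of R Y))
  have hid : F.map (ModuleCat.ofHom s) ≫ F.map (ModuleCat.ofHom r) =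
      𝟙 (F.obj (ModuleCat.of R A)) := by
    rw [← F.map_comp, ← ModuleCat.ofHom_comp, h]
    exact F.map_id _
  have hinj : Function.Injective (F.map (ModuleCat.ofHom s)) := fun a b hab => by
    have := congrArg (F.map (ModuleCat.ofHom r)) hab
    rwa [← ConcreteCategory.comp_apply, ← ConcreteCategory.comp_apply, hid,
      ConcreteCategory.id_apply, ConcreteCategory.id_apply] at this
  exact @Function.Injective.subsingleton _ _ _ hinj hB

theorem subsingleton_extMod_of_projective [Module.Projective R A] {i : ℕ} (hi : i ≠ 0) :
    Subsingleton (extMod R i A Y) := by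
  obtain ⟨j, rfl⟩ := Nat.exists_eq_succ_of_ne_zero hi
  have : Projective (ModuleCat.of R A) := (IsProjective.iff_projective A).1 inferInstance
  exact (subsingleton_extMod_iff _ A Y).2 (Abelian.Ext.subsingleton_of_projective _ _ j)

theorem subsingleton_extMod_of_subsingleton_left [Subsingleton A] {i : ℕ} :
    Subsingleton (extMod R i A Y) := by
  rcases eq_or_ne i 0 with rfl | hi
  · exact extMod_zero_subsingleton_iff.2 inferInstance
  · exact subsingleton_extMod_of_projective hi

variable {f : A →ₗ[R] B} {g : B →ₗ[R] C}

/-- The short exact sequence of modules given by an exact pair of maps. -/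
theorem shortExact_of_exact (hf : Function.Injective f) (hfg : Function.Exact f g)
    (hg : Function.Surjective g) :
    (ModuleCat.shortComplexOfCompEqZero f g hfg.linearMap_comp_eq_zero).ShortExact :=
  ModuleCat.shortComplex_shortExact _ hfg hf hg

theorem subsingleton_extMod_left_middle (hf : Function.Injective f) (hfg : Function.Exact f g)
    (hg : Function.Surjective g) {i : ℕ} (hA : Subsingleton (extMod R i A Y))
    (hC : Subsingleton (extMod R i C Y)) : Subsingleton (extMod R i B Y) := by
  rw [subsingleton_extMod_iff] at *
  refine subsingleton_of_forall_eq 0 fun x => ?_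
  obtain ⟨y, rfl⟩ := Abelian.Ext.contravariant_sequence_exact₂ (shortExact_of_exact hf hfg hg) _ x
    (hA.elim _ _)
  rw [hC.elim y 0, Abelian.Ext.comp_zero]

theorem subsingleton_extMod_left_sub (hf : Function.Injective f) (hfg : Function.Exact f g)
    (hg : Function.Surjective g) {i : ℕ} (hB : Subsingleton (extMod R i B Y))
    (hC : Subsingleton (extMod R (i + 1) C Y)) : Subsingleton (extMod R i A Y) := by
  rw [subsingleton_extMod_iff] at *
  refine subsingleton_of_forall_eq 0 fun x => ?_
  obtain ⟨y, rfl⟩ := Abelian.Ext.contravariant_sequence_exact₁ (shortExact_of_exact hf hfg hg) _ x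
    (add_comm 1 i) (hC.elim _ _)
  rw [hB.elim y 0, Abelian.Ext.comp_zero]

theorem subsingleton_extMod_left_quotient (hf : Function.Injective f) (hfg : Function.Exact f g)
    (hg : Function.Surjective g) {i : ℕ} (hA : Subsingleton (extMod R i A Y))
    (hB : Subsingleton (extMod R (i + 1) B Y)) : Subsingleton (extMod R (i + 1) C Y) := by
  rw [subsingleton_extMod_iff] at *
  refine subsingleton_of_forall_eq 0 fun x => ?_
  obtain ⟨y, rfl⟩ := Abelian.Ext.contravariant_sequence_exact₃ (shortExact_of_exact hf hfg hg) _ x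
    (hB.elim _ _) (add_comm 1 i)
  rw [hA.elim y 0, Abelian.Ext.comp_zero]

theorem subsingleton_extMod_right_quotient (hf : Function.Injective f) (hfg : Function.Exact f g)
    (hg : Function.Surjective g) {i : ℕ} (hB : Subsingleton (extMod R i Y B))
    (hA : Subsingleton (extMod R (i + 1) Y A)) : Subsingleton (extMod R i Y C) := by
  rw [subsingleton_extMod_iff] at *
  refine subsingleton_of_forall_eq 0 fun x => ?_
  obtain ⟨y, rfl⟩ := Abelian.Ext.covariant_sequence_exact₃ _ (shortExact_of_exact hf hfg hg) x
    rfl (hA.elim _ _)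
  rw [hB.elim y 0, Abelian.Ext.zero_comp]

theorem exists_comp_eq_of_subsingleton_extMod_one (hf : Function.Injective f)
    (hfg : Function.Exact f g) (hg : Function.Surjective g)
    (hC : Subsingleton (extMod R 1 C Y)) (u : A →ₗ[R] Y) : ∃ v : B →ₗ[R] Y, v ∘ₗ f = u := by
  rw [subsingleton_extMod_iff] at hC
  obtain ⟨y, hy⟩ := Abelian.Ext.contravariant_sequence_exact₁ (shortExact_of_exact hf hfg hg)
    (ModuleCat.of R Y) (Abelian.Ext.mk₀ (ModuleCat.ofHom u)) (add_comm 1 0) (hC.elim _ _)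
  obtain ⟨v, rfl⟩ := (Abelian.Ext.mk₀_bijective _ _).2 y
  rw [Abelian.Ext.mk₀_comp_mk₀] at hy
  exact ⟨v.hom, congrArg ModuleCat.Hom.hom ((Abelian.Ext.mk₀_bijective _ _).1 hy)⟩

theorem exists_comp_eq_right_of_subsingleton_extMod_one (hf : Function.Injective f)
    (hfg : Function.Exact f g) (hg : Function.Surjective g)
    (hA : Subsingleton (extMod R 1 Y A)) (u : Y →ₗ[R] C) : ∃ v : Y →ₗ[R] B, g ∘ₗ v = u := by
  rw [subsingleton_extMod_iff] at hA
  obtain ⟨y, hy⟩ := Abelian.Ext.covariant_sequence_exact₃ (ModuleCat.of R Y)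
    (shortExact_of_exact hf hfg hg) (Abelian.Ext.mk₀ (ModuleCat.ofHom u)) rfl (hA.elim _ _)
  obtain ⟨v, rfl⟩ := (Abelian.Ext.mk₀_bijective _ _).2 y
  rw [Abelian.Ext.mk₀_comp_mk₀] at hy
  exact ⟨v.hom, congrArg ModuleCat.Hom.hom ((Abelian.Ext.mk₀_bijective _ _).1 hy)⟩

theorem subsingleton_extMod_of_smul [IsNoetherianRing R] [IsLocalRing R] [Module.Finite R A]
    [Module.Finite R Y] {x : R} (hx : x ∈ IsLocalRing.maximalIdeal R) (hreg : IsSMulRegular A x)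
    {i : ℕ} (h : Subsingleton (extMod R (i + 1) (QuotSMulTop x A) Y)) :
    Subsingleton (extMod R i A Y) := by
  rw [subsingleton_extMod_iff] at *
  have hS := IsSMulRegular.smulShortComplex_shortExact (M := ModuleCat.of R A) hreg
  by_contra hn
  rw [not_subsingleton_iff_nontrivial] at hn
  have hj : x ∈ (Module.annihilator R
      (Abelian.Ext (ModuleCat.of R A) (ModuleCat.of R Y) i)).jacobson :=
    IsLocalRing.maximalIdeal_le_jacobson _ hx
  refine Submodule.top_ne_pointwise_smul_of_mem_jacobson_annihilator hj (Eq.symm ?_)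
  rw [eq_top_iff]
  intro z _
  obtain ⟨y, rfl⟩ := Abelian.Ext.contravariant_sequence_exact₁ hS (ModuleCat.of R Y) z
    (add_comm 1 i) (h.elim _ _)
  have hsmul (w : Abelian.Ext (ModuleCat.of R A) (ModuleCat.of R Y) i) :
      (Abelian.Ext.mk₀ (x • 𝟙 (ModuleCat.of R A))).comp w (zero_add i) = x • w := by
    rw [Abelian.Ext.mk₀_smul, Abelian.Ext.smul_comp, Abelian.Ext.mk₀_id_comp]
  exact hsmul y ▸ Submodule.smul_mem_pointwise_smul _ _ ⊤ trivial

end ExtVanishing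

section Gorenstein

open IsLocalRing RingTheory.Sequence
open scoped Pointwise

variable {R : Type} [CommRing R]

theorem subsingleton_extMod_quotSMulTop_left {A Y : Type} [AddCommGroup A] [Module R A]
    [AddCommGroup Y] [Module R Y] {x : R} (hx : IsSMulRegular A x) {i : ℕ}
    (h : Subsingleton (extMod R i A Y)) (h' : Subsingleton (extMod R (i + 1) A Y)) :
    Subsingleton (extMod R (i + 1) (QuotSMulTop x A) Y) :=
  subsingleton_extMod_left_quotient (f := LinearMap.lsmul R A x) hx
    (LinearMap.exact_lsmul_mkQ_smul_top A x) (Submodule.mkQ_surjective _) h h'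

theorem subsingleton_extMod_quotSMulTop_right {A Y : Type} [AddCommGroup A] [Module R A]
    [AddCommGroup Y] [Module R Y] {x : R} (hx : IsSMulRegular Y x) {i : ℕ}
    (h : Subsingleton (extMod R i A Y)) (h' : Subsingleton (extMod R (i + 1) A Y)) :
    Subsingleton (extMod R i A (QuotSMulTop x Y)) :=
  subsingleton_extMod_right_quotient (f := LinearMap.lsmul R Y x) hx
    (LinearMap.exact_lsmul_mkQ_smul_top Y x) (Submodule.mkQ_surjective _) h h'

theorem hasFiniteInjDim_hom_quotSMulTop {M N : Type} [AddCommGroup M] [Module R M]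
    [AddCommGroup N] [Module R N] {x : R} (hx : IsSMulRegular N x)
    (h : HasFiniteInjDim R (M →ₗ[R] N)) (hext : Subsingleton (extMod R 1 M N)) :
    HasFiniteInjDim R (M →ₗ[R] QuotSMulTop x N) := by
  obtain ⟨n, hn⟩ := h
  refine ⟨n, fun L _ _ i hi => ?_⟩
  have hexact := LinearMap.exact_lsmul_mkQ_smul_top N x
  have hinj : Function.Injective (LinearMap.lsmul R N x) := hx
  have hsurj := Submodule.mkQ_surjective (x • (⊤ : Submodule R N))
  refine subsingleton_extMod_right_quotient (f := (LinearMap.lsmul R N x).compRight R (M := M))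
    (g := ((x • (⊤ : Submodule R N)).mkQ).compRight R (M := M)) ?_ ?_ ?_
    (hn L i hi) (hn L (i + 1) (by omega))
  · intro u v huv
    ext m
    exact hinj (LinearMap.congr_fun huv m)
  · intro u
    constructor
    · intro hu
      have hmem (m : M) : ∃ n, LinearMap.lsmul R N x n = u m :=
        (hexact (u m)).1 (LinearMap.congr_fun hu m)
      choose v hv using hmem
      refine ⟨⟨⟨v, fun a b => hinj ?_⟩, fun r a => hinj ?_⟩, ?_⟩
      · simp only [map_add, hv]
      · simp only [hv, map_smul, RingHom.id_apply]
      · ext m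
        exact hv m
    · rintro ⟨v, rfl⟩
      ext m
      exact hexact.apply_apply_eq_zero (v m)
  · intro u
    exact exists_comp_eq_right_of_subsingleton_extMod_one hinj hexact hsurj hext u

variable [IsLocalRing R]

theorem support_quotient_maximalIdeal :
    Module.support R (R ⧸ maximalIdeal R) = PrimeSpectrum.zeroLocus (maximalIdeal R) := by
  rw [Module.support_eq_zeroLocus, Ideal.annihilator_quotient]

theorem maximalIdeal_smul_top_lt_top {N : Type} [AddCommGroup N] [Module R N] [Module.Finite R N]
    [Nontrivial N] : maximalIdeal R • (⊤ : Submodule R N) < ⊤ :=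
  (Submodule.top_ne_ideal_smul_of_le_jacobson_annihilator
    (maximalIdeal_le_jacobson _)).symm.lt_top

variable [IsNoetherianRing R]

theorem length_le_of_isRegular {d : ℕ} (hd : ringKrullDim R = d) {N : Type} [AddCommGroup N]
    [Module R N] [Module.Finite R N] {rs : List R} (hrs : IsRegular N rs) : rs.length ≤ d := by
  have h := Module.supportDim_add_length_eq_supportDim_of_isRegular rs hrs
  have : Nontrivial (N ⧸ Ideal.ofList rs • (⊤ : Submodule R N)) :=
    Submodule.Quotient.nontrivial_iff.2 hrs.top_ne_smul.symm
  have h0 : 0 ≤ Module.supportDim R (N ⧸ Ideal.ofList rs • (⊤ : Submodule R N)) := by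
    rcases h' : Module.supportDim R (N ⧸ Ideal.ofList rs • (⊤ : Submodule R N)) with _ | e
    · exact absurd h' (Module.supportDim_ne_bot_of_nontrivial R _)
    · exact WithBot.coe_le_coe.2 (zero_le (a := e))
  have h1 : ((rs.length : ℕ) : WithBot ℕ∞) ≤ (d : ℕ) := by
    calc ((rs.length : ℕ) : WithBot ℕ∞) = 0 + rs.length := (zero_add _).symm
      _ ≤ _ := add_le_add_left h0 _
      _ = _ := h
      _ ≤ _ := Module.supportDim_le_ringKrullDim R N
      _ = _ := hd
  exact_mod_cast h1

theorem exists_isRegular_of_subsingleton_extMod {N : Type} [AddCommGroup N] [Module R N]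
    [Module.Finite R N] [Nontrivial N] {n : ℕ}
    (h : ∀ i < n, Subsingleton (extMod R i (R ⧸ maximalIdeal R) N)) :
    ∃ rs : List R, rs.length = n ∧ (∀ r ∈ rs, r ∈ maximalIdeal R) ∧ IsRegular N rs :=
  ModuleCat.exists_isRegular_of_exists_subsingleton_ext (maximalIdeal R) n (ModuleCat.of R N)
    maximalIdeal_smul_top_lt_top (ModuleCat.of R (R ⧸ maximalIdeal R))
    support_quotient_maximalIdeal fun i hi => (subsingleton_extMod_iff _ _ _).1 (h i hi)

theorem exists_isRegular_length_eq_moduleDepth {N : Type} [AddCommGroup N] [Module R N]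
    [Module.Finite R N] [Nontrivial N] : ∃ rs : List R, rs.length = moduleDepth R N ∧
      (∀ r ∈ rs, r ∈ maximalIdeal R) ∧ IsRegular N rs :=
  exists_isRegular_of_subsingleton_extMod fun _ hi => not_not.1 (Nat.notMem_of_lt_sInf hi)

theorem length_le_moduleDepth {d : ℕ} (hd : ringKrullDim R = d) {N : Type} [AddCommGroup N]
    [Module R N] [Module.Finite R N] [Nontrivial N] {rs : List R}
    (hmem : ∀ r ∈ rs, r ∈ maximalIdeal R) (hrs : IsRegular N rs) :
    rs.length ≤ moduleDepth R N := by
  refine le_csInf ?_ fun i hi => ?_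
  · by_contra hempty
    obtain ⟨ss, hlen, -, hss⟩ := exists_isRegular_of_subsingleton_extMod (N := N) (n := d + 1)
      fun i _ => by_contra fun hi => hempty ⟨i, hi⟩
    have := length_le_of_isRegular hd hss
    omega
  · by_contra hlt
    exact hi <| (subsingleton_extMod_iff _ _ _).2 <|
      ModuleCat.subsingleton_ext_of_exists_isRegular (maximalIdeal R)
        (ModuleCat.of R (R ⧸ maximalIdeal R)) support_quotient_maximalIdeal.subset
        (ModuleCat.of R N) maximalIdeal_smul_top_lt_top rs hmem hrs i (not_le.1 hlt)

theorem exists_isSMulRegular_or_exists_injective (N : Type) [AddCommGroup N] [Module R N]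
    [Module.Finite R N] : (∃ x ∈ maximalIdeal R, IsSMulRegular N x) ∨
      ∃ f : R ⧸ maximalIdeal R →ₗ[R] N, Function.Injective f := by
  by_cases h : ∃ x ∈ maximalIdeal R, IsSMulRegular N x
  · exact .inl h
  · rw [← Ideal.annihilator_quotient (I := maximalIdeal R),
      ← IsSMulRegular.subsingleton_linearMap_iff, not_subsingleton_iff_nontrivial] at h
    obtain ⟨f, hf⟩ := exists_ne (0 : R ⧸ maximalIdeal R →ₗ[R] N)
    have : IsSimpleModule R (R ⧸ maximalIdeal R) :=
      isSimpleModule_iff_quot_maximal.2 ⟨_, inferInstance, ⟨LinearEquiv.refl _ _⟩⟩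
    exact .inr ⟨f, LinearMap.injective_of_ne_zero hf⟩

/-- Dividing a module by a maximal regular sequence, one element at a time, ends with a module of
depth zero. -/
theorem exists_quotient_of_depth_zero {b : ℕ} {N : Type} [AddCommGroup N] [Module R N]
    [Module.Finite R N] [Nontrivial N] (hb : ∀ rs : List R, IsRegular N rs → rs.length ≤ b)
    {P : ℕ → ∀ (Q : Type) [AddCommGroup Q] [Module R Q], Prop} (h0 : P 0 N)
    (hstep : ∀ (n : ℕ) (Q : Type) [AddCommGroup Q] [Module R Q], ∀ x ∈ maximalIdeal R,
      IsSMulRegular Q x → P n Q → P (n + 1) (QuotSMulTop x Q)) :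
    ∃ rs : List R, (∀ r ∈ rs, r ∈ maximalIdeal R) ∧ IsRegular N rs ∧
      ∃ (Q : Type) (_ : AddCommGroup Q) (_ : Module R Q), Module.Finite R Q ∧
        P rs.length Q ∧ ∃ f : R ⧸ maximalIdeal R →ₗ[R] Q, Function.Injective f := by
  induction b generalizing N P with
  | zero =>
    rcases exists_isSMulRegular_or_exists_injective (R := R) N with ⟨x, hx, hreg⟩ | hf
    · have := nontrivial_quotSMulTop_of_mem_maximalIdeal N hx
      simpa using hb _ ((isRegular_cons_iff N x []).2 ⟨hreg, IsRegular.nil R (QuotSMulTop x N)⟩)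
    · exact ⟨[], by simp, IsRegular.nil R N, N, ‹_›, ‹_›, inferInstance, h0, hf⟩
  | succ b ih =>
    rcases exists_isSMulRegular_or_exists_injective (R := R) N with ⟨x, hx, hreg⟩ | hf
    · have := nontrivial_quotSMulTop_of_mem_maximalIdeal N hx
      obtain ⟨rs, hmem, hrs, Q, hQ⟩ := ih (N := QuotSMulTop x N) (P := fun n => P (n + 1))
        (fun rs hrs => by
          simpa using hb _ ((isRegular_cons_iff N x rs).2 ⟨hreg, hrs⟩)) (hstep 0 N x hx hreg h0)
        (fun n => hstep (n + 1))
      exact ⟨x :: rs, List.forall_mem_cons.2 ⟨hx, hmem⟩, (isRegular_cons_iff N x rs).2 ⟨hreg, hrs⟩, Q, hQ⟩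
    · exact ⟨[], by simp, IsRegular.nil R N, N, ‹_›, ‹_›, inferInstance, h0, hf⟩

theorem subsingleton_extMod_of_residueField {Y : Type} [AddCommGroup Y] [Module R Y]
    [Module.Finite R Y] {n : ℕ}
    (h : ∀ (L : Type) [AddCommGroup L] [Module R L], Module.Finite R L →
      Subsingleton (extMod R (n + 1) L Y))
    (hk : Subsingleton (extMod R n (R ⧸ maximalIdeal R) Y))
    (L : Type) [AddCommGroup L] [Module R L] [hL : Module.Finite R L] :
    Subsingleton (extMod R n L Y) := by
  induction hL using IsNoetherianRing.induction_on_isQuotientEquivQuotientPrime R with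
  | subsingleton N => exact subsingleton_extMod_of_subsingleton_left
  | quotient N p e =>
    refine subsingleton_extMod_of_equiv_left e.symm ?_
    by_cases hp : p.asIdeal = maximalIdeal R
    · rwa [hp]
    · obtain ⟨x, hx, hxp⟩ := SetLike.exists_of_lt
        ((le_maximalIdeal p.isPrime.ne_top).lt_of_ne hp)
      refine subsingleton_extMod_of_smul hx ?_ (h _ inferInstance)
      refine (isSMulRegular_iff_right_eq_zero_of_smul).2 fun y hy => ?_
      obtain ⟨y, rfl⟩ := Ideal.Quotient.mk_surjective y
      rw [← Ideal.Quotient.mk_eq_mk, ← Submodule.Quotient.mk_smul, Ideal.Quotient.mk_eq_mk,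
        Ideal.Quotient.eq_zero_iff_mem] at hy
      exact Ideal.Quotient.eq_zero_iff_mem.2 ((p.isPrime.mem_or_mem hy).resolve_left hxp)
  | exact N₁ N₂ N₃ f g hf hg hfg h₁ h₃ => exact subsingleton_extMod_left_middle hf hfg hg h₁ h₃

theorem subsingleton_extMod_self_of_lt {d : ℕ} (hd : ringKrullDim R = d)
    (hR : HasFiniteInjDim R R) (L : Type) [AddCommGroup L] [Module R L] [Module.Finite R L]
    {i : ℕ} (hi : d < i) : Subsingleton (extMod R i L R) := by
  obtain ⟨rs, -, hrs, Q, _, _, hfin, hQ, f, hf⟩ := exists_quotient_of_depth_zero (N := R)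
    (fun rs => length_le_of_isRegular hd)
    (P := fun n Q _ _ => ∀ i, n < i → Subsingleton (extMod R i Q R))
    (fun i hi => subsingleton_extMod_of_projective hi.ne') fun n Q _ _ x _ hreg hQ i hi => by
      obtain ⟨j, rfl⟩ := Nat.exists_eq_add_of_lt hi
      exact subsingleton_extMod_quotSMulTop_left hreg (hQ _ (by omega)) (hQ _ (by omega))
  have hlen := length_le_of_isRegular hd hrs
  obtain ⟨n, hn⟩ := hR
  have key (m : ℕ) : (∀ (L : Type) [AddCommGroup L] [Module R L], Module.Finite R L →
      ∀ i, d + m < i → Subsingleton (extMod R i L R)) → ∀ (L : Type) [AddCommGroup L] [Module R L],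
      Module.Finite R L → ∀ i, d < i → Subsingleton (extMod R i L R) := by
    induction m with
    | zero => exact id
    | succ m ih =>
      refine fun h => ih fun L _ _ _ i hi => ?_
      rcases (show d + (m + 1) ≤ i by omega).eq_or_lt with rfl | hlt
      · refine subsingleton_extMod_of_residueField (fun L _ _ hL => h L hL _ (by omega)) ?_ L
        exact subsingleton_extMod_left_sub hf (LinearMap.exact_map_mkQ_range f)
          (Submodule.mkQ_surjective _) (hQ _ (by omega)) (h _ inferInstance _ (by omega))
      · exact h L inferInstance i hlt
  exact key n (fun L _ _ _ i hi => hn L i (by omega)) L inferInstance i hi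

theorem subsingleton_extMod_self_of_isRegular {d : ℕ} (hd : ringKrullDim R = d)
    (hR : HasFiniteInjDim R R) {rs : List R} (hmem : ∀ r ∈ rs, r ∈ maximalIdeal R)
    (M : Type) [AddCommGroup M] [Module R M] [Module.Finite R M] (hrs : IsWeaklyRegular M rs)
    {i : ℕ} (hi : d < i + rs.length) : Subsingleton (extMod R i M R) := by
  induction rs generalizing M i with
  | nil => exact subsingleton_extMod_self_of_lt hd hR M hi
  | cons x rs ih =>
    rw [isWeaklyRegular_cons_iff] at hrs
    simp only [List.mem_cons, forall_eq_or_imp] at hmem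
    refine subsingleton_extMod_of_smul hmem.1 hrs.1 (ih hmem.2 _ hrs.2 ?_)
    rw [List.length_cons] at hi
    omega

end Gorenstein

section TotallyReflexive

open IsLocalRing

variable {R : Type} [CommRing R]

theorem LinearMap.exists_comp_eq_of_ker_le {A B C : Type} [AddCommGroup A] [Module R A]
    [AddCommGroup B] [Module R B] [AddCommGroup C] [Module R C] {g : A →ₗ[R] B}
    (hg : Function.Surjective g) {u : A →ₗ[R] C} (h : LinearMap.ker g ≤ LinearMap.ker u) :
    ∃ v : B →ₗ[R] C, v ∘ₗ g = u := by
  refine ⟨(LinearMap.ker g).liftQ u h ∘ₗ (g.quotKerEquivOfSurjective hg).symm.toLinearMap, ?_⟩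
  ext a
  have : (g.quotKerEquivOfSurjective hg).symm (g a) = (LinearMap.ker g).mkQ a := by
    rw [LinearEquiv.symm_apply_eq]
    rfl
  simp [this]

theorem LinearMap.exact_dualMap_of_surjective {A B : Type} [AddCommGroup A] [Module R A]
    [AddCommGroup B] [Module R B] {g : A →ₗ[R] B} (hg : Function.Surjective g) :
    Function.Exact g.dualMap (LinearMap.ker g).subtype.dualMap := by
  intro u
  constructor
  · intro hu
    obtain ⟨v, hv⟩ := LinearMap.exists_comp_eq_of_ker_le hg (u := u) fun a ha =>
      LinearMap.congr_fun hu ⟨a, ha⟩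
    exact ⟨v, hv⟩
  · rintro ⟨v, rfl⟩
    ext ⟨a, ha⟩
    simp [LinearMap.mem_ker.1 ha]

theorem surjective_dualMap_subtype_ker {F M : Type} [AddCommGroup F] [Module R F]
    [AddCommGroup M] [Module R M] {p : F →ₗ[R] M} (hp : Function.Surjective p)
    (hM : ∀ i ≠ 0, Subsingleton (extMod R i M R)) :
    Function.Surjective (LinearMap.ker p).subtype.dualMap := fun u =>
  exists_comp_eq_of_subsingleton_extMod_one (Subtype.val_injective) p.exact_subtype_ker_map hp
    (hM 1 one_ne_zero) u

theorem subsingleton_extMod_ker {F M : Type} [AddCommGroup F] [Module R F]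
    [Module.Projective R F] [AddCommGroup M] [Module R M] {p : F →ₗ[R] M}
    (hp : Function.Surjective p)
    (hM : ∀ i ≠ 0, Subsingleton (extMod R i M R)) (i : ℕ) (hi : i ≠ 0) :
    Subsingleton (extMod R i (LinearMap.ker p) R) :=
  subsingleton_extMod_left_sub (f := (LinearMap.ker p).subtype) (Subtype.val_injective)
    p.exact_subtype_ker_map hp (subsingleton_extMod_of_projective hi) (hM _ i.succ_ne_zero)

theorem hasFiniteInjDim_of_hom {M N : Type} [AddCommGroup M] [Module R M] [Module.Free R M]
    [Nontrivial M] [AddCommGroup N] [Module R N] (h : HasFiniteInjDim R (M →ₗ[R] N)) :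
    HasFiniteInjDim R N := by
  obtain ⟨n, hn⟩ := h
  let b := Module.Free.chooseBasis R M
  obtain ⟨i⟩ := b.index_nonempty
  refine ⟨n, fun L _ _ j hj => subsingleton_extMod_of_retract_right
    (LinearMap.smulRightₗ (b.coord i)) (LinearMap.applyₗ (b i)) ?_ (hn L j hj)⟩
  ext x
  simp

variable [IsNoetherianRing R]

theorem subsingleton_extMod_dual {Y : Type} [AddCommGroup Y] [Module R Y]
    (hY : HasFiniteInjDim R Y) (M : Type) [AddCommGroup M] [Module R M] [Module.Finite R M]
    (hM : ∀ i ≠ 0, Subsingleton (extMod R i M R)) {i : ℕ} (hi : i ≠ 0) :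
    Subsingleton (extMod R i (Module.Dual R M) Y) := by
  obtain ⟨n, hn⟩ := hY
  have key (j : ℕ) : ∀ (M : Type) [AddCommGroup M] [Module R M] [Module.Finite R M],
      (∀ i ≠ 0, Subsingleton (extMod R i M R)) → ∀ i ≠ 0, n < i + j →
        Subsingleton (extMod R i (Module.Dual R M) Y) := by
    induction j with
    | zero => exact fun M _ _ _ _ i _ hi => hn _ i hi
    | succ j ih =>
      intro M _ _ _ hM i hi hij
      obtain ⟨k, p, hp⟩ := Module.Finite.exists_fin' R M
      exact subsingleton_extMod_left_sub (LinearMap.dualMap_injective_of_surjective hp)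
        (LinearMap.exact_dualMap_of_surjective hp) (surjective_dualMap_subtype_ker hp hM)
        (subsingleton_extMod_of_projective hi)
        (ih _ (subsingleton_extMod_ker hp hM) (i + 1) i.succ_ne_zero (by omega))
  exact key (n + 1) M hM i hi (by omega)

theorem apply_eq_zero_of_forall_dual_smul_eq_zero {M Q : Type} [AddCommGroup M] [Module R M]
    [Module.Finite R M] [AddCommGroup Q] [Module R Q]
    (hM : ∀ i ≠ 0, Subsingleton (extMod R i M R)) (hY : HasFiniteInjDim R (M →ₗ[R] Q))
    {m : M} {y : M →ₗ[R] Q} (hy : ∀ f : M →ₗ[R] R, f m • y = 0) : y m = 0 := by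
  obtain ⟨k, p, hp⟩ := Module.Finite.exists_fin' R M
  obtain ⟨l, q, hq⟩ := Module.Finite.exists_fin' R (LinearMap.ker p)
  obtain ⟨e, rfl⟩ := hp m
  have hK := subsingleton_extMod_ker hp hM
  obtain ⟨v, hv⟩ := LinearMap.exists_comp_eq_of_ker_le (surjective_dualMap_subtype_ker hp hM)
    (u := (LinearMap.applyₗ (R := R) e : ((Fin k → R) →ₗ[R] R) →ₗ[R] R).smulRight y) (by
      intro φ hφ
      obtain ⟨f, rfl⟩ := (LinearMap.exact_dualMap_of_surjective hp φ).1 hφ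
      exact hy f)
  obtain ⟨H, rfl⟩ := exists_comp_eq_of_subsingleton_extMod_one
    (LinearMap.dualMap_injective_of_surjective hq) (LinearMap.exact_dualMap_of_surjective hq)
    (surjective_dualMap_subtype_ker hq hK)
    (subsingleton_extMod_dual hY _ (subsingleton_extMod_ker hq hK) one_ne_zero) v
  have hH (φ : (Fin k → R) →ₗ[R] R) :
      φ e • y = ∑ j, φ (q (Pi.single j 1)) • H (LinearMap.proj j) := by
    have h1 : H (φ ∘ₗ (LinearMap.ker p).subtype ∘ₗ q) = φ e • y := LinearMap.congr_fun hv φ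
    have h2 : φ ∘ₗ (LinearMap.ker p).subtype ∘ₗ q =
        ∑ j, φ (q (Pi.single j 1)) • (LinearMap.proj j : (Fin l → R) →ₗ[R] R) := by
      ext j
      simp [Pi.single_apply]
    rw [← h1, h2, map_sum]
    simp
  have he : y (p e) = ∑ i, (e i • y) (p (Pi.single i 1)) := by
    conv_lhs => rw [pi_eq_sum_univ' e]
    simp
  rw [he]
  have h2 (i : Fin k) : e i • y = _ := hH (LinearMap.proj i)
  simp_rw [h2, LinearMap.sum_apply]
  rw [Finset.sum_comm]
  refine Finset.sum_eq_zero fun j _ => ?_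
  have h3 : p (q (Pi.single j 1) : Fin k → R) = 0 := (q (Pi.single j 1)).2
  rw [pi_eq_sum_univ' (q (Pi.single j 1) : Fin k → R)] at h3
  simpa using congrArg (H (LinearMap.proj j)) h3

variable [IsLocalRing R]

theorem free_of_hasFiniteInjDim_hom {M Q : Type} [AddCommGroup M] [Module R M]
    [Module.Finite R M] [AddCommGroup Q] [Module R Q]
    (hM : ∀ i ≠ 0, Subsingleton (extMod R i M R)) (hY : HasFiniteInjDim R (M →ₗ[R] Q))
    {ι : ResidueField R →ₗ[R] Q} (hι : Function.Injective ι) : Module.Free R M := by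
  obtain ⟨n, s, hs⟩ := Module.Finite.exists_fin' R (M →ₗ[R] R)
  let Φ : M →ₗ[R] (Fin n → R) := LinearMap.pi fun i => s (Pi.single i 1)
  have hΦ : Function.Injective (Φ.lTensor (ResidueField R)) := by
    refine (injective_iff_map_eq_zero _).2 fun z hz => ?_
    obtain ⟨m, rfl⟩ : ∃ m : M, (1 : ResidueField R) ⊗ₜ[R] m = z :=
      TensorProduct.mk_surjective R M (ResidueField R) residue_surjective z
    have hmem (f : M →ₗ[R] R) : f m ∈ maximalIdeal R := by
      obtain ⟨c, rfl⟩ := hs f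
      have hi (i : Fin n) : s (Pi.single i 1) m ∈ maximalIdeal R := by
        have := congrArg ((TensorProduct.rid R (ResidueField R)).toLinearMap ∘ₗ
          (LinearMap.proj i : (Fin n → R) →ₗ[R] R).lTensor (ResidueField R)) hz
        simpa [Φ, Algebra.smul_def] using this
      rw [pi_eq_sum_univ' c]
      simpa using Ideal.sum_mem _ fun i _ => Ideal.mul_mem_left _ (c i) (hi i)
    by_contra hne
    obtain ⟨l, hl⟩ := Module.Projective.exists_dual_ne_zero (ResidueField R) hne
    let g : M →ₗ[R] ResidueField R :=
      l.restrictScalars R ∘ₗ TensorProduct.mk R (ResidueField R) M 1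
    refine hl (hι ((map_zero ι).symm ▸ ?_))
    refine apply_eq_zero_of_forall_dual_smul_eq_zero hM hY (m := m) (y := ι ∘ₗ g) fun f => ?_
    ext w
    have hw : f m • g w = 0 := by
      rw [Algebra.smul_def, ResidueField.algebraMap_eq, (residue_eq_zero_iff _).2 (hmem f),
        zero_mul]
    rw [LinearMap.smul_apply, LinearMap.comp_apply, ← map_smul, hw, map_zero, LinearMap.zero_apply]
  obtain ⟨t, ht⟩ := (split_injective_iff_lTensor_residueField_injective Φ).2 hΦ
  have := Module.Projective.of_split Φ t ht
  exact Module.free_of_flat_of_isLocalRing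

end TotallyReflexive

theorem free_of_mcm_over_gorenstein
    (R : Type) [CommRing R] [IsNoetherianRing R] [IsLocalRing R]
    (d : ℕ) (hd : ringKrullDim R = d)
    (hGor : HasFiniteInjDim R R)
    (M N : Type) [AddCommGroup M] [Module R M] [AddCommGroup N] [Module R N]
    [Module.Finite R M] [Module.Finite R N] [Nontrivial M] [Nontrivial N]
    (hMmcm : moduleDepth R M = d)
    (hinj : HasFiniteInjDim R (M →ₗ[R] N))
    (hext : ∀ i : ℕ, 1 ≤ i → i ≤ moduleDepth R N → Subsingleton (extMod R i M N)) :
    Module.Free R M ∧ HasFiniteInjDim R N := by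
  have hM (i : ℕ) (hi : i ≠ 0) : Subsingleton (extMod R i M R) := by
    obtain ⟨rs, hlen, hmem, hrs⟩ := exists_isRegular_length_eq_moduleDepth (R := R) (N := M)
    exact subsingleton_extMod_self_of_isRegular hd hGor hmem M hrs.toIsWeaklyRegular (by omega)
  obtain ⟨rs, hmem, hrs, Q, _, _, -, hQ, ι, hι⟩ := exists_quotient_of_depth_zero (N := N)
    (fun rs => length_le_of_isRegular hd)
    (P := fun n Q _ _ => n ≤ moduleDepth R N → HasFiniteInjDim R (M →ₗ[R] Q) ∧
      ∀ i, 1 ≤ i → i + n ≤ moduleDepth R N → Subsingleton (extMod R i M Q))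
    (fun _ => ⟨hinj, hext⟩) fun n Q _ _ x _ hreg hQ hn => by
      obtain ⟨h1, h2⟩ := hQ (by omega)
      exact ⟨hasFiniteInjDim_hom_quotSMulTop hreg h1 (h2 1 le_rfl (by omega)), fun i hi hin =>
        subsingleton_extMod_quotSMulTop_right hreg (h2 i hi (by omega))
          (h2 (i + 1) (by omega) (by omega))⟩
  have := free_of_hasFiniteInjDim_hom hM (hQ (length_le_moduleDepth hd hmem hrs)).1 hι
  exact ⟨this, hasFiniteInjDim_of_hom hinj⟩
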